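/- The xCL behaviour bifunctor B^u(X,Y) = ▷Y + (▷Y)^{▷X} on the topos of trees has a locally final coalgebra, i.e. there exists a higher-order B^u-coalgebra z : Z → B^u(Z,Z) that is a final coalgebra for the endofunctor B^u(Z,−). -/

import Mathlib

universe u

/-- An object of the topos of trees `Set^{ω^op}`: a family of sets `(X_n)` with
restriction maps `X_{n+1} → X_n` (generating all restrictions `X_n → X_m`, `n ≥ m`). -/
structure OmTree : Type (u + 1) where
  obj : ℕ → Type u
  res : ∀ n : ℕ, obj (n + 1) → obj n

/-- A morphism of `Set^{ω^op}`: a natural transformation. -/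
@[ext]
structure OmTreeHom (X Y : OmTree.{u}) where
  app : ∀ n : ℕ, X.obj n → Y.obj n
  natural : ∀ (n : ℕ) (x : X.obj (n + 1)), Y.res n (app (n + 1) x) = app n (X.res n x)

/-- The identity morphism. -/
def OmTreeHom.id (X : OmTree.{u}) : OmTreeHom X X :=
  ⟨fun _ x => x, fun _ _ => rfl⟩

/-- Composition (diagrammatic order). -/
def OmTreeHom.comp {X Y Z : OmTree.{u}} (f : OmTreeHom X Y) (g : OmTreeHom Y Z) : OmTreeHom X Z where
  app n x := g.app n (f.app n x)
  natural n x := by rw [g.natural, f.natural]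

/-- The object part of the later modality: `(▷X)_0 = 1`, `(▷X)_{n+1} = X_n`. -/
def laterObj (X : OmTree.{u}) : ℕ → Type u
  | 0 => PUnit
  | n + 1 => X.obj n

/-- The restrictions of the later modality. -/
def laterRes (X : OmTree.{u}) : ∀ n : ℕ, laterObj X (n + 1) → laterObj X n
  | 0 => fun _ => PUnit.unit
  | n + 1 => X.res n

/-- The later modality `▷ : Set^{ω^op} → Set^{ω^op}` on objects. -/
def later (X : OmTree.{u}) : OmTree.{u} := ⟨laterObj X, laterRes X⟩

/-- The action of `▷` on morphisms. -/
def laterMap {X Y : OmTree.{u}} (f : OmTreeHom X Y) : OmTreeHom (later X) (later Y) where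
  app n := match n with
    | 0 => fun x => x
    | n + 1 => f.app n
  natural n x := by cases n with
    | zero => rfl
    | succ m => exact f.natural m x

/-- An element of the exponential `(Y^X)_n` in `Set^{ω^op}`: a tuple of maps
`(f_i : X_i → Y_i)_{i ≤ n}` commuting with the restriction maps. -/
structure ExpEl (X Y : OmTree.{u}) (n : ℕ) : Type u where
  comp : ∀ i : ℕ, i ≤ n → X.obj i → Y.obj i
  natural : ∀ (i : ℕ) (h : i + 1 ≤ n) (x : X.obj (i + 1)),
    Y.res i (comp (i + 1) h x) = comp i (Nat.le_of_succ_le h) (X.res i x)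

/-- Restriction of exponentials. -/
def expRes (X Y : OmTree.{u}) (n : ℕ) (e : ExpEl X Y (n + 1)) : ExpEl X Y n where
  comp i h := e.comp i (Nat.le_succ_of_le h)
  natural i h x := e.natural i (Nat.le_succ_of_le h) x

/-- The xCL behaviour bifunctor on objects: `B^u(X,Y) = ▷Y + (▷Y)^{▷X}`. -/
def BuObj (X Y : OmTree.{u}) : OmTree.{u} where
  obj n := laterObj Y n ⊕ ExpEl (later X) (later Y) n
  res n := Sum.map (laterRes Y n) (expRes (later X) (later Y) n)

/-- Precomposition of an exponential element with a morphism. -/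
def expPre {X X' Y : OmTree.{u}} (f : OmTreeHom X X') (n : ℕ) (e : ExpEl X' Y n) :
    ExpEl X Y n where
  comp i h x := e.comp i h (f.app i x)
  natural i h x := by rw [e.natural, f.natural]

/-- Postcomposition of an exponential element with a morphism. -/
def expPost {X Y Y' : OmTree.{u}} (g : OmTreeHom Y Y') (n : ℕ) (e : ExpEl X Y n) :
    ExpEl X Y' n where
  comp i h x := g.app i (e.comp i h x)
  natural i h x := by rw [g.natural, e.natural]

/-- The contravariant action of `B^u` in its first argument: `B^u(f, id)`. -/
def BuMapL {X X' : OmTree.{u}} (Y : OmTree.{u}) (f : OmTreeHom X X') :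
    OmTreeHom (BuObj X' Y) (BuObj X Y) where
  app n := Sum.map (fun y => y) (expPre (laterMap f) n)
  natural n x := by cases x <;> rfl

/-- The covariant action of `B^u` in its second argument: `B^u(id, g)`. -/
def BuMapR (X : OmTree.{u}) {Y Y' : OmTree.{u}} (g : OmTreeHom Y Y') :
    OmTreeHom (BuObj X Y) (BuObj X Y') where
  app n := Sum.map ((laterMap g).app n) (expPost (laterMap g) n)
  natural n x := by
    cases x with
    | inl y => exact congrArg Sum.inl ((laterMap g).natural n y)
    | inr e => rfl

@[ext]
theorem ExpEl.ext {X Y : OmTree.{u}} {n : ℕ} {e e' : ExpEl X Y n}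
    (h : ∀ i hi x, e.comp i hi x = e'.comp i hi x) : e = e' := by
  cases e
  cases e'
  congr
  funext i hi x
  exact h i hi x

namespace ExpEl

/-- An element of `(Y^X)_n` together with a compatible map in degree `n + 1` is an element
of `(Y^X)_{n+1}`. -/
def extend {X Y : OmTree.{u}} {n : ℕ} (f : ExpEl X Y n) (g : X.obj (n + 1) → Y.obj (n + 1))
    (h : ∀ x, Y.res n (g x) = f.comp n le_rfl (X.res n x)) : ExpEl X Y (n + 1) where
  comp i hi := if hin : i ≤ n then f.comp i hin else
    (show i = n + 1 by omega) ▸ g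
  natural i hi x := by
    rcases Nat.lt_or_ge i n with hin | hin
    · rw [dif_pos (show i + 1 ≤ n from hin), dif_pos hin.le]
      exact f.natural i hin x
    · obtain rfl : i = n := by omega
      rw [dif_neg (by omega), dif_pos le_rfl]
      exact h x

theorem expRes_extend {X Y : OmTree.{u}} {n : ℕ} (f : ExpEl X Y n)
    (g : X.obj (n + 1) → Y.obj (n + 1))
    (h : ∀ x, Y.res n (g x) = f.comp n le_rfl (X.res n x)) :
    expRes X Y n (f.extend g h) = f := by
  ext i hi x
  simp [expRes, extend, hi]

theorem extend_comp_last {X Y : OmTree.{u}} {n : ℕ} (f : ExpEl X Y n)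
    (g : X.obj (n + 1) → Y.obj (n + 1))
    (h : ∀ x, Y.res n (g x) = f.comp n le_rfl (X.res n x)) :
    (f.extend g h).comp (n + 1) le_rfl = g := by
  simp [extend]

theorem ext_of_expRes {X Y : OmTree.{u}} {n : ℕ} {e e' : ExpEl X Y (n + 1)}
    (h : expRes X Y n e = expRes X Y n e')
    (hlast : e.comp (n + 1) le_rfl = e'.comp (n + 1) le_rfl) : e = e' := by
  ext i hi x
  rcases Nat.lt_or_ge n i with hin | hin
  · obtain rfl : i = n + 1 := by omega
    rw [hlast]
  · exact congrArg (fun k : ExpEl X Y n => k.comp i hin x) h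

/-- A morphism, truncated at degree `n`. -/
def ofHom {X Y : OmTree.{u}} (g : OmTreeHom X Y) (n : ℕ) : ExpEl X Y n :=
  ⟨fun i _ => g.app i, fun i _ => g.natural i⟩

/-- The action of the later modality on truncated morphisms. -/
def shift {X Y : OmTree.{u}} {n : ℕ} (f : ExpEl X Y n) : ExpEl (later X) (later Y) (n + 1) where
  comp i := match i with
    | 0 => fun _ x => x
    | i + 1 => fun h => f.comp i (Nat.le_of_succ_le_succ h)
  natural i h x := by
    cases i with
    | zero => rfl
    | succ i => exact f.natural i (Nat.le_of_succ_le_succ h) x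

theorem expRes_shift {X Y : OmTree.{u}} {n : ℕ} (f : ExpEl X Y (n + 1)) :
    expRes _ _ _ f.shift = (expRes _ _ _ f).shift := by
  ext i hi x
  cases i <;> rfl

theorem shift_ofHom {X Y : OmTree.{u}} (g : OmTreeHom X Y) (n : ℕ) :
    (ofHom g n).shift = ofHom (laterMap g) (n + 1) := by
  ext i hi x
  cases i <;> rfl

theorem later_zero_eq {X Y : OmTree.{u}} (e e' : ExpEl (later X) (later Y) 0) : e = e' := by
  ext i hi x
  obtain rfl : i = 0 := by omega
  rfl

/-- Postcomposition with a truncated morphism. -/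
def post {W X Y : OmTree.{u}} {n : ℕ} (k : ExpEl X Y n) (i : ℕ) (hi : i ≤ n)
    (e : ExpEl W X i) : ExpEl W Y i where
  comp j hj x := k.comp j (hj.trans hi) (e.comp j hj x)
  natural j hj x := by rw [k.natural, e.natural]

end ExpEl

/-- The endofunctor `L ↦ L + L^L` on objects, so that `B^u(X,X)` is its value at `▷X`. -/
def sumExp (L : OmTree.{u}) : OmTree.{u} where
  obj n := L.obj n ⊕ ExpEl L L n
  res n := Sum.map (L.res n) (expRes L L n)

/-- One stage of the construction of the fixed point of `Z ↦ ▷Z + (▷Z)^{▷Z}`: at stage `n`,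
`carrier` is `(▷Z)_n`, `fn` is `((▷Z)^{▷Z})_n`, `res` is the restriction
`(▷Z)_{n+1} → (▷Z)_n` and `top` is the degree `n` component of an exponential element. -/
structure FixStage : Type (u + 1) where
  carrier : Type u
  fn : Type u
  res : carrier ⊕ fn → carrier
  top : fn → carrier → carrier

/-- The stages of the fixed point. -/
def fixStage : ℕ → FixStage.{u}
  | 0 => ⟨PUnit, PUnit, fun _ => PUnit.unit, fun _ x => x⟩
  | n + 1 =>
    let S := fixStage n
    { carrier := S.carrier ⊕ S.fn
      fn := {p : S.fn × (S.carrier ⊕ S.fn → S.carrier ⊕ S.fn) //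
        ∀ a, S.res (p.2 a) = S.top p.1 (S.res a)}
      res := Sum.map S.res (fun p => p.1.1)
      top := fun p => p.1.2 }

/-- The carrier of the locally final coalgebra. -/
def fixTree : OmTree.{u} :=
  ⟨fun n => (fixStage n).carrier ⊕ (fixStage n).fn, fun n => (fixStage (n + 1)).res⟩

/-- A presentation of `▷ fixTree`. -/
def laterFixTree : OmTree.{u} :=
  ⟨fun n => (fixStage n).carrier, fun n => (fixStage n).res⟩

theorem later_fixTree : later fixTree.{u} = laterFixTree := by
  have hobj : laterObj fixTree.{u} = fun n => (fixStage n).carrier := by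
    funext n
    cases n <;> rfl
  unfold later laterFixTree
  congr 1
  refine Function.hfunext rfl fun n m hnm => ?_
  cases hnm
  cases n <;> rfl

/-- The exponential element represented by an element of `(fixStage n).fn`. -/
def fixFn : ∀ (n : ℕ) (e : (fixStage.{u} n).fn),
    {f : ExpEl laterFixTree.{u} laterFixTree n // f.comp n le_rfl = (fixStage n).top e}
  | 0, e => ⟨⟨fun i hi => Nat.le_zero.mp hi ▸ (fixStage.{u} 0).top e,
      fun i hi => absurd hi (Nat.not_succ_le_zero i)⟩, rfl⟩
  | n + 1, e =>
    ⟨(fixFn n e.1.1).1.extend e.1.2 fun a => by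
      rw [(fixFn n e.1.1).2]
      exact e.2 a, ExpEl.extend_comp_last _ _ _⟩

theorem expRes_fixFn (n : ℕ) (e : (fixStage.{u} (n + 1)).fn) :
    expRes _ _ n (fixFn (n + 1) e).1 = (fixFn n e.1.1).1 :=
  ExpEl.expRes_extend (fixFn n e.1.1).1 e.1.2 fun a => by
    rw [(fixFn n e.1.1).2]
    exact e.2 a

theorem fixFn_bijective (n : ℕ) : Function.Bijective fun e => (fixFn.{u} n e).1 := by
  induction n with
  | zero =>
    refine ⟨fun _ _ _ => rfl, fun f => ⟨PUnit.unit, ?_⟩⟩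
    ext i hi x
    obtain rfl : i = 0 := by omega
    rfl
  | succ n ih =>
    constructor
    · intro e e' h
      have h : (fixFn (n + 1) e).1 = (fixFn (n + 1) e').1 := h
      have h₁ : e.1.1 = e'.1.1 := ih.1 (by
        change (fixFn n e.1.1).1 = (fixFn n e'.1.1).1
        rw [← expRes_fixFn, ← expRes_fixFn, h])
      have h₂ : e.1.2 = e'.1.2 :=
        (fixFn (n + 1) e).2.symm.trans
          ((congrArg (fun k => k.comp (n + 1) le_rfl) h).trans (fixFn (n + 1) e').2)
      exact Subtype.ext (Prod.ext h₁ h₂)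
    · intro f
      obtain ⟨e, he⟩ := ih.2 (expRes _ _ n f)
      have he : (fixFn n e).1 = expRes _ _ n f := he
      refine ⟨⟨(e, f.comp (n + 1) le_rfl), fun a => ?_⟩, ?_⟩
      · rw [← (fixFn n e).2, he]
        exact f.natural n le_rfl a
      · refine ExpEl.ext_of_expRes ?_ ?_
        · exact (expRes_fixFn n _).trans he
        · exact (fixFn (n + 1) _).2

/-- The unfolding of the fixed point. -/
def fixUnfold : OmTreeHom fixTree.{u} (sumExp laterFixTree) where
  app n := Sum.map (fun a => a) (fun e => (fixFn n e).1)
  natural n x := by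
    cases x with
    | inl a => rfl
    | inr e => exact congrArg Sum.inr (expRes_fixFn n e)

theorem fixUnfold_bijective (n : ℕ) : Function.Bijective (fixUnfold.{u}.app n) :=
  ⟨Function.Injective.sumMap Function.injective_id (fixFn_bijective n).1,
    Function.Surjective.sumMap Function.surjective_id (fixFn_bijective n).2⟩

theorem exists_fixed_point : ∃ (Z : OmTree.{u}) (z : OmTreeHom Z (BuObj Z Z)),
    ∀ n, Function.Bijective (z.app n) := by
  have h : ∃ z : OmTreeHom fixTree.{u} (sumExp (later fixTree)),
      ∀ n, Function.Bijective (z.app n) := by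
    rw [later_fixTree]
    exact ⟨fixUnfold, fixUnfold_bijective⟩
  exact ⟨fixTree, h⟩

/-- The truncated version of the action `B^u(Z, g)`, with `▷g` replaced by `k`. -/
def BuPost (W : OmTree.{u}) {X Y : OmTree.{u}} {n : ℕ} (k : ExpEl (later X) (later Y) n) (i : ℕ)
    (hi : i ≤ n) : (BuObj W X).obj i → (BuObj W Y).obj i :=
  Sum.map (k.comp i hi) (k.post i hi)

theorem BuPost_natural (W : OmTree.{u}) {X Y : OmTree.{u}} {n : ℕ}
    (k : ExpEl (later X) (later Y) n) (i : ℕ) (hi : i + 1 ≤ n) (b : (BuObj W X).obj (i + 1)) :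
    (BuObj W Y).res i (BuPost W k (i + 1) hi b) =
      BuPost W k i (Nat.le_of_succ_le hi) ((BuObj W X).res i b) := by
  cases b with
  | inl y => exact congrArg Sum.inl (k.natural i hi y)
  | inr e => rfl

theorem exists_corec_step {X Z : OmTree.{u}} (c : OmTreeHom X (BuObj Z X))
    (z : OmTreeHom Z (BuObj Z Z)) (hz : ∀ n, Function.Bijective (z.app n)) (n : ℕ) (k : ExpEl (later X) (later Z) n) :
    ∃ f : ExpEl X Z n, ∀ i hi x, z.app i (f.comp i hi x) = BuPost Z k i hi (c.app i x) := by
  choose f hf using fun i (hi : i ≤ n) x => (hz i).2 (BuPost Z k i hi (c.app i x))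
  refine ⟨⟨f, fun i hi x => (hz i).1 ?_⟩, hf⟩
  rw [← z.natural, hf, hf, ← c.natural, BuPost_natural]

/-- The compatible sequence of truncations of `▷h`, for `h` the corecursive morphism obtained
by iterating `G`. -/
def corecApprox {X Z : OmTree.{u}}
    (G : ∀ n, ExpEl (later X) (later Z) n → ExpEl X Z n) :
    ∀ n, ExpEl (later X) (later Z) n
  | 0 => ⟨fun _ hi _ => (Nat.le_zero.mp hi).symm ▸ PUnit.unit,
      fun i hi => absurd hi (Nat.not_succ_le_zero i)⟩
  | n + 1 => (G n (corecApprox G n)).shift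

theorem expRes_corecApprox {X Z : OmTree.{u}}
    (G : ∀ n, ExpEl (later X) (later Z) n → ExpEl X Z n)
    (hG : ∀ n k, expRes _ _ n (G (n + 1) k) = G n (expRes _ _ n k)) (n : ℕ) :
    expRes _ _ n (corecApprox G (n + 1)) = corecApprox G n := by
  induction n with
  | zero => exact ExpEl.later_zero_eq _ _
  | succ n ih =>
    change expRes _ _ _ (G (n + 1) (corecApprox G (n + 1))).shift = (G n (corecApprox G n)).shift
    rw [ExpEl.expRes_shift, hG, ih]

/-- A family of maps on truncated morphisms which is compatible with truncation and
contractive has a unique fixed point. -/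
theorem existsUnique_corec {X Z : OmTree.{u}}
    (G : ∀ n, ExpEl (later X) (later Z) n → ExpEl X Z n)
    (hG : ∀ n k, expRes _ _ n (G (n + 1) k) = G n (expRes _ _ n k)) :
    ∃! h : OmTreeHom X Z, ∀ n, ExpEl.ofHom h n = G n (ExpEl.ofHom (laterMap h) n) := by
  have key : ∀ h : OmTreeHom X Z,
      (∀ n, ExpEl.ofHom h n = G n (corecApprox G n)) →
      ∀ n, ExpEl.ofHom (laterMap h) n = corecApprox G n := by
    intro h hh n
    cases n with
    | zero => exact ExpEl.later_zero_eq _ _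
    | succ n => rw [← ExpEl.shift_ofHom, hh]; rfl
  have hres : ∀ n, expRes _ _ n (G (n + 1) (corecApprox G (n + 1))) = G n (corecApprox G n) :=
    fun n => by rw [hG, expRes_corecApprox G hG]
  let h : OmTreeHom X Z :=
    ⟨fun n => (G n (corecApprox G n)).comp n le_rfl, fun n x => by
      rw [(G (n + 1) _).natural n le_rfl x, ← hres n]
      rfl⟩
  have hh : ∀ n, ExpEl.ofHom h n = G n (corecApprox G n) := by
    intro n
    induction n with
    | zero =>
      ext i hi x
      obtain rfl : i = 0 := by omega
      rfl
    | succ n ih =>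
      refine ExpEl.ext_of_expRes ?_ rfl
      rw [hres, ← ih]
      rfl
  refine ⟨h, fun n => by rw [key h hh]; exact hh n, fun h' hh' => ?_⟩
  have hlater : ∀ n, ExpEl.ofHom (laterMap h') n = corecApprox G n := by
    intro n
    induction n with
    | zero => exact ExpEl.later_zero_eq _ _
    | succ n ih => rw [← ExpEl.shift_ofHom, hh', ih]; rfl
  ext n x
  have := (hh' n).trans ((congrArg (G n) (hlater n)).trans (hh n).symm)
  exact congrArg (fun k : ExpEl X Z n => k.comp n le_rfl x) this

/-- A fixed point of `Z ↦ B^u(Z,Z)` is a locally final coalgebra. -/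
theorem existsUnique_hom_of_bijective {X Z : OmTree.{u}} (c : OmTreeHom X (BuObj Z X))
    (z : OmTreeHom Z (BuObj Z Z)) (hz : ∀ n, Function.Bijective (z.app n)) :
    ∃! h : OmTreeHom X Z, h.comp z = c.comp (BuMapR Z h) := by
  choose G hG using exists_corec_step c z hz
  have hcompat : ∀ n k, expRes _ _ n (G (n + 1) k) = G n (expRes _ _ n k) := by
    intro n k
    ext i hi x
    exact (hz i).1 ((hG (n + 1) k i (Nat.le_succ_of_le hi) x).trans
      (hG n (expRes _ _ n k) i hi x).symm)
  have hiff : ∀ h : OmTreeHom X Z, h.comp z = c.comp (BuMapR Z h) ↔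
      ∀ n, ExpEl.ofHom h n = G n (ExpEl.ofHom (laterMap h) n) := by
    intro h
    constructor
    · intro e n
      ext i hi x
      refine (hz i).1 ?_
      rw [hG]
      exact congrArg (fun g : OmTreeHom X (BuObj Z Z) => g.app i x) e
    · intro e
      ext n x
      have h₁ := congrArg (fun k : ExpEl X Z n => z.app n (k.comp n le_rfl x)) (e n)
      exact h₁.trans (hG _ _ _ _ _)
  simp only [hiff]
  exact existsUnique_corec G hcompat

/-- The xCL behaviour bifunctor `B^u(X,Y) = ▷Y + (▷Y)^{▷X}` on the
topos of trees has a locally final coalgebra: a higher-order coalgebra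
`z : Z → B^u(Z,Z)` that is a final coalgebra for the endofunctor `B^u(Z,−)`. -/
theorem xCL_locally_final_exists :
    ∃ (Z : OmTree.{u}) (z : OmTreeHom Z (BuObj Z Z)),
      ∀ (X : OmTree.{u}) (c : OmTreeHom X (BuObj Z X)),
        ∃! h : OmTreeHom X Z, h.comp z = c.comp (BuMapR Z h) := by
  obtain ⟨Z, z, hz⟩ := exists_fixed_point.{u}
  exact ⟨Z, z, fun _ c => existsUnique_hom_of_bijective c z hz⟩
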